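/- arXiv:1904.02227 — 4 statements merged into one kernel-verified Lean document; each statement's English description precedes it below -/
import Mathlib

section
/- Let (X, μ) be a probability space, T : X → X a μ-preserving transformation, and φ : X → ℝ an integrable mean-zero observable. Suppose φ satisfies a large deviation principle with rate function I defined on the open neighborhood U of 0. Fix α > 0 with α ∈ U and set ℓ_n := ⌊(log n)/I(α)⌋ for n ∈ ℕ. Then the upper Erdős–Rényi law holds: for μ-almost every x ∈ X, limsup_{n→∞} max_{0 ≤ j ≤ n−ℓ_n} (1/ℓ_n) S_{ℓ_n}(φ)(T^j x) ≤ α. -/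
open MeasureTheory Filter Set

/-- The `n`-th Birkhoff sum `S_n(φ) = φ + φ∘T + … + φ∘T^{n−1}`. -/
noncomputable def birkhoff {X : Type*} (T : X → X) (φ : X → ℝ) (n : ℕ) (x : X) : ℝ :=
  ∑ i ∈ Finset.range n, φ (T^[i] x)

theorem StrictConvexOn.lt_of_zero_eq_zero {U : Set ℝ} {I : ℝ → ℝ} (hI : StrictConvexOn ℝ U I)
    (h0 : (0 : ℝ) ∈ U) (hI0 : I 0 = 0) {a b : ℝ} (hb : b ∈ U) (hIb : 0 ≤ I b)
    (ha0 : 0 < a) (hab : a < b) : I a < I b := by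
  have hb0 : 0 < b := ha0.trans hab
  have ht1 : a / b < 1 := (div_lt_one hb0).2 hab
  have h := hI.2 h0 hb hb0.ne (sub_pos.2 ht1) (div_pos ha0 hb0) (by ring)
  simp only [smul_eq_mul, mul_zero, zero_add, hI0] at h
  rw [div_mul_cancel₀ _ hb0.ne'] at h
  nlinarith

/-- The real `limsup` is bounded by `a ≥ 0` as soon as the sequence is eventually below numbers
arbitrarily close to `a`; if it is not bounded below, the `limsup` takes the default value `0`. -/
theorem Real.limsup_le_of_eventually_le_seq {f : ℕ → ℝ} {a : ℝ} (ha : 0 ≤ a) {u : ℕ → ℝ}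
    (hu : Tendsto u atTop (nhds a)) (h : ∀ k, ∀ᶠ n in atTop, f n ≤ u k) :
    limsup f atTop ≤ a := by
  rw [limsup_eq]
  by_cases hb : BddBelow {b | ∀ᶠ n in atTop, f n ≤ b}
  · exact ge_of_tendsto' hu fun k => csInf_le hb (h k)
  · rw [Real.sInf_of_not_bddBelow hb]
    exact ha

theorem eventually_le_exp_of_tendsto_log_div {p : ℕ → ℝ} (hp : ∀ n, 0 ≤ p n) {c r : ℝ}
    (hcr : c < r) (h : Tendsto (fun n : ℕ => Real.log (p n) / n) atTop (nhds (-r))) :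
    ∀ᶠ n : ℕ in atTop, p n ≤ Real.exp (-(c * n)) := by
  filter_upwards [h.eventually_lt_const (neg_lt_neg hcr), eventually_gt_atTop 0] with n hn hn0
  rcases (hp n).eq_or_lt with h0 | h0
  · rw [← h0]
    positivity
  · rw [div_lt_iff₀ (by exact_mod_cast hn0)] at hn
    rw [← Real.log_le_iff_le_exp h0]
    linarith

theorem ae_eventually_forall_iterate_notMem {X : Type*} [MeasurableSpace X] {μ : Measure X}
    [IsProbabilityMeasure μ] {T : X → X} (hT : MeasurePreserving T μ μ) {B : ℕ → Set X}
    {a c : ℝ} (ha : 0 ≤ a) (hac : a < c)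
    (hB : ∀ᶠ l : ℕ in atTop, (μ (B l)).toReal ≤ Real.exp (-(c * l))) :
    ∀ᵐ x ∂μ, ∀ᶠ l : ℕ in atTop,
      ∀ j : ℕ, (j : ℝ) ≤ Real.exp ((l + 1) * a) → T^[j] x ∉ B l := by
  let A : ℕ → Set X := fun l =>
    ⋃ j ∈ Finset.range (⌊Real.exp ((l + 1) * a)⌋₊ + 1), T^[j] ⁻¹' B l
  have hA : ∀ l, (μ (A l)).toReal ≤ (Real.exp ((l + 1) * a) + 1) * (μ (B l)).toReal := by
    intro l
    have hpre (j : ℕ) : μ.real (T^[j] ⁻¹' B l) ≤ μ.real (B l) := by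
      refine ENNReal.toReal_mono (measure_ne_top _ _) ?_
      have h := Measure.le_map_apply (μ := μ) (hT.iterate j).measurable.aemeasurable (B l)
      rwa [(hT.iterate j).map_eq] at h
    calc μ.real (A l)
        ≤ ∑ j ∈ Finset.range (⌊Real.exp ((l + 1) * a)⌋₊ + 1), μ.real (T^[j] ⁻¹' B l) :=
          measureReal_biUnion_finset_le _ _
      _ ≤ ∑ j ∈ Finset.range (⌊Real.exp ((l + 1) * a)⌋₊ + 1), μ.real (B l) :=
          Finset.sum_le_sum fun j _ => hpre j
      _ = ((⌊Real.exp ((l + 1) * a)⌋₊ : ℝ) + 1) * μ.real (B l) := by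
          simp
      _ ≤ (Real.exp ((l + 1) * a) + 1) * μ.real (B l) := by
          gcongr
          exact Nat.floor_le (Real.exp_pos _).le
  have hsum : Summable fun l => (μ (A l)).toReal := by
    have hg : Summable fun l : ℕ => 2 * Real.exp a * Real.exp (-(c - a)) ^ l :=
      (summable_geometric_of_lt_one (Real.exp_pos _).le
        (by rw [Real.exp_lt_one_iff]; linarith)).mul_left _
    refine hg.of_norm_bounded_eventually_nat ?_
    filter_upwards [hB] with l hl
    rw [Real.norm_of_nonneg ENNReal.toReal_nonneg]
    have h1 : 1 ≤ Real.exp ((l + 1) * a) := Real.one_le_exp (by positivity)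
    calc (μ (A l)).toReal ≤ (Real.exp ((l + 1) * a) + 1) * (μ (B l)).toReal := hA l
      _ ≤ (2 * Real.exp ((l + 1) * a)) * Real.exp (-(c * l)) := by
          gcongr
          linarith
      _ = 2 * Real.exp a * Real.exp (-(c - a)) ^ l := by
          rw [← Real.exp_nat_mul, mul_assoc, mul_assoc, ← Real.exp_add, ← Real.exp_add]
          ring_nf
  have htop : ∑' l, μ (A l) ≠ ⊤ := by
    have h := hsum.tsum_ofReal_ne_top
    simpa only [ENNReal.ofReal_toReal (measure_ne_top μ _)] using h
  filter_upwards [ae_eventually_notMem htop] with x hx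
  filter_upwards [hx] with l hl j hj hmem
  refine hl (mem_biUnion (x := j) ?_ hmem)
  simpa [Nat.lt_succ_iff] using Nat.le_floor hj

/-- Upper Erdős–Rényi law: if `φ` satisfies a large deviation principle with rate
function `I` on the open neighborhood `U` of `0`, and `α > 0` lies in `U`, then with
`ℓ_n = ⌊(log n)/I(α)⌋`, for a.e. `x`,
`limsup_n max_{0 ≤ j ≤ n−ℓ_n} (1/ℓ_n) S_{ℓ_n}(φ)(T^j x) ≤ α`. -/
theorem upper_erdos_renyi_law
    {X : Type*} [MeasurableSpace X] (μ : Measure X) [IsProbabilityMeasure μ]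
    (T : X → X) (hT : MeasurePreserving T μ μ)
    (φ : X → ℝ) (hφint : Integrable φ μ) (hφmean : ∫ x, φ x ∂μ = 0)
    (U : Set ℝ) (hUopen : IsOpen U) (hU0 : (0 : ℝ) ∈ U)
    (I : ℝ → ℝ) (hIconv : StrictConvexOn ℝ U I)
    (hInonneg : ∀ a ∈ U, 0 ≤ I a) (hIzero : ∀ a ∈ U, (I a = 0 ↔ a = 0))
    (hLDPpos : ∀ a ∈ U, 0 < a →
      Tendsto (fun n : ℕ =>
          Real.log ((μ {x | (n : ℝ) * a ≤ birkhoff T φ n x}).toReal) / (n : ℝ))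
        atTop (nhds (-(I a))))
    (hLDPneg : ∀ a ∈ U, a < 0 →
      Tendsto (fun n : ℕ =>
          Real.log ((μ {x | birkhoff T φ n x ≤ (n : ℝ) * a}).toReal) / (n : ℝ))
        atTop (nhds (-(I a))))
    (α : ℝ) (hα : 0 < α) (hαU : α ∈ U) :
    ∀ᵐ x ∂μ,
      limsup (fun n : ℕ =>
          (Finset.range (n - ⌊Real.log n / I α⌋₊ + 1)).sup'
            (Finset.nonempty_range_iff.mpr (Nat.succ_ne_zero _))
            (fun j =>
              birkhoff T φ ⌊Real.log n / I α⌋₊ (T^[j] x) / (⌊Real.log n / I α⌋₊ : ℝ)))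
        atTop ≤ α := by
  have hIpos : 0 < I α := (hInonneg α hαU).lt_of_ne fun h => hα.ne' ((hIzero α hαU).1 h.symm)
  have hlen : Tendsto (fun n : ℕ => ⌊Real.log n / I α⌋₊) atTop atTop :=
    tendsto_nat_floor_atTop.comp
      ((Real.tendsto_log_atTop.comp tendsto_natCast_atTop_atTop).atTop_div_const hIpos)
  have key : ∀ β ∈ U, α < β → ∀ᵐ x ∂μ, ∀ᶠ n : ℕ in atTop,
      (Finset.range (n - ⌊Real.log n / I α⌋₊ + 1)).sup'
        (Finset.nonempty_range_iff.mpr (Nat.succ_ne_zero _))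
        (fun j =>
          birkhoff T φ ⌊Real.log n / I α⌋₊ (T^[j] x) / (⌊Real.log n / I α⌋₊ : ℝ)) ≤ β := by
    intro β hβU hαβ
    obtain ⟨c, hαc, hcβ⟩ := exists_between
      (hIconv.lt_of_zero_eq_zero hU0 ((hIzero 0 hU0).2 rfl) hβU (hInonneg β hβU) hα hαβ)
    have hB := eventually_le_exp_of_tendsto_log_div (fun _ => ENNReal.toReal_nonneg) hcβ
      (hLDPpos β hβU (hα.trans hαβ))
    filter_upwards [ae_eventually_forall_iterate_notMem hT hIpos.le hαc hB] with x hx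
    filter_upwards [hlen.eventually hx, hlen.eventually_gt_atTop 0, eventually_gt_atTop 0]
      with n hn hlpos hnpos
    refine Finset.sup'_le _ _ fun j hj => ?_
    have hjn : j ≤ n := by
      have := Finset.mem_range.1 hj
      omega
    have hn0 : (0 : ℝ) < n := by exact_mod_cast hnpos
    have hjexp : (j : ℝ) ≤ Real.exp ((⌊Real.log n / I α⌋₊ + 1) * I α) := by
      refine le_trans (Nat.cast_le.2 hjn) ((Real.log_le_iff_le_exp hn0).1 ?_)
      exact ((div_lt_iff₀ hIpos).1 (Nat.lt_floor_add_one _)).le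
    have h := not_le.1 (hn j hjexp)
    rw [div_le_iff₀ (by exact_mod_cast hlpos), mul_comm]
    exact h.le
  obtain ⟨b, hαb, hbU⟩ := mem_nhdsGE_iff_exists_Ico_subset.1
    (mem_nhdsWithin_of_mem_nhds (hUopen.mem_nhds hαU))
  obtain ⟨u, -, huIoo, hu⟩ := exists_seq_strictAnti_tendsto' (mem_Ioi.1 hαb)
  filter_upwards [ae_all_iff.2 fun k =>
    key (u k) (hbU (Ioo_subset_Ico_self (huIoo k))) (huIoo k).1] with x hx
  exact Real.limsup_le_of_eventually_le_seq hα.le hu hx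
end

section
/- Let (X, d) be a compact metric space with a Borel probability measure μ and T : X → X a μ-preserving map. Let p be a periodic point of T of period τ, and suppose there are K > 1 and an open neighborhood V of the orbit of p on which T is Lipschitz with constant K (this holds in particular when X is a compact Riemannian manifold and T is C¹ on a neighborhood of the orbit of p). Suppose there exists γ > 0 such that for μ-almost every x ∈ X one has T^n(x) ∈ B(p, n^{−γ}) for infinitely many n. Let φ : X \ {p} → ℝ be continuous with lim_{x→p} φ(x) = +∞, ∫_X φ dμ = 0, and φ > −ρ for some ρ > 0. Then the stationary process {φ∘T^j} does not satisfy exponential large deviations with a rate function: there is no open neighborhood U of 0 and strictly convex non-negative function I : U → ℝ, vanishing only at 0, such that lim_{n→∞} (1/n) log μ(S_n(φ) ≥ nα) = −I(α) for all α > 0 in U and lim_{n→∞} (1/n) log μ(S_n(φ) ≤ nα) = −I(α) for all α < 0 in U. -/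
open MeasureTheory Filter Set

/-- `φ` satisfies exponential large deviations with a (strictly convex) rate function
`I` defined on the open neighborhood `U` of `0`. -/
def HasRateFunction {X : Type*} [MeasurableSpace X] (μ : Measure X)
    (T : X → X) (φ : X → ℝ) : Prop :=
  ∃ (U : Set ℝ) (I : ℝ → ℝ),
    IsOpen U ∧ (0 : ℝ) ∈ U ∧ StrictConvexOn ℝ U I ∧
    (∀ a ∈ U, 0 ≤ I a) ∧ (∀ a ∈ U, (I a = 0 ↔ a = 0)) ∧
    (∀ a ∈ U, 0 < a →
      Tendsto (fun n : ℕ =>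
          Real.log ((μ {x | (n : ℝ) * a ≤ birkhoff T φ n x}).toReal) / (n : ℝ))
        atTop (nhds (-(I a)))) ∧
    (∀ a ∈ U, a < 0 →
      Tendsto (fun n : ℕ =>
          Real.log ((μ {x | birkhoff T φ n x ≤ (n : ℝ) * a}).toReal) / (n : ℝ))
        atTop (nhds (-(I a))))

theorem exists_ball_subset_of_periodic {X : Type*} [MetricSpace X] {T : X → X} {p : X} {τ : ℕ}
    (hτ : 0 < τ) (hper : T^[τ] p = p) {V : Set X} (hV : IsOpen V) (horb : ∀ i : ℕ, T^[i] p ∈ V) :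
    ∃ r > 0, ∀ i : ℕ, Metric.ball (T^[i] p) r ⊆ V := by
  have hp : Function.IsPeriodicPt T τ p := hper
  have h : ∀ i : ℕ, ∃ r > 0, Metric.ball (T^[i] p) r ⊆ V :=
    fun i => Metric.isOpen_iff.1 hV _ (horb i)
  choose r hr hrV using h
  have hne : (Finset.range τ).Nonempty := Finset.nonempty_range_iff.2 hτ.ne'
  refine ⟨(Finset.range τ).inf' hne r, (Finset.lt_inf'_iff hne).2 fun i _ => hr i, fun i => ?_⟩
  rw [← hp.iterate_mod_apply i]
  exact (Metric.ball_subset_ball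
    (Finset.inf'_le r (Finset.mem_range.2 (Nat.mod_lt i hτ)))).trans (hrV _)

theorem dist_iterate_le_pow_mul_dist {X : Type*} [MetricSpace X] {T : X → X} {p y : X} {K r : ℝ}
    (hK : 1 ≤ K) (hr : 0 < r) {V : Set X} (hV : ∀ i : ℕ, Metric.ball (T^[i] p) r ⊆ V)
    (hLip : ∀ x ∈ V, ∀ y ∈ V, dist (T x) (T y) ≤ K * dist x y) (k : ℕ)
    (hk : K ^ k * dist y p < r) : dist (T^[k] y) (T^[k] p) ≤ K ^ k * dist y p := by
  induction k with
  | zero => simp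
  | succ k ih =>
    have hle : K ^ k * dist y p ≤ K ^ (k + 1) * dist y p := by
      gcongr
      exact k.le_succ
    have hlt := hle.trans_lt hk
    have h := ih hlt
    rw [Function.iterate_succ_apply', Function.iterate_succ_apply', pow_succ', mul_assoc]
    refine (hLip _ (hV k (h.trans_lt hlt)) _ (hV k (Metric.mem_ball_self hr))).trans ?_
    gcongr

/-- If `φ` is bounded below by `-ρ` and large at the times `0, τ, …, (m - 1)τ`, then the
Birkhoff average up to the longer time `L m τ` is still at least `a`. -/
theorem mul_le_birkhoff_of_large_along_period {X : Type*} {T : X → X} {φ : X → ℝ} {ρ a : ℝ}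
    (hρ : ∀ x, -ρ ≤ φ x) {τ : ℕ} (hτ : 0 < τ) {L : ℕ} (hL : 1 ≤ L) (m : ℕ) (y : X)
    (h : ∀ j < m, (a + ρ) * (L * τ) ≤ φ (T^[j * τ] y) + ρ) :
    ((L * m * τ : ℕ) : ℝ) * a ≤ birkhoff T φ (L * m * τ) y := by
  have hsub : (Finset.range m).image (· * τ) ⊆ Finset.range (L * m * τ) := by
    intro i hi
    obtain ⟨j, hj, rfl⟩ := Finset.mem_image.1 hi
    rw [Finset.mem_range] at hj ⊢
    exact (Nat.mul_lt_mul_right hτ).2 (hj.trans_le (Nat.le_mul_of_pos_left m hL))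
  have hsum : ∑ j ∈ Finset.range m, (φ (T^[j * τ] y) + ρ) ≤
      ∑ i ∈ Finset.range (L * m * τ), (φ (T^[i] y) + ρ) := by
    rw [← Finset.sum_image (f := fun i => φ (T^[i] y) + ρ) (g := (· * τ))
      (fun i _ j _ hij => Nat.eq_of_mul_eq_mul_right hτ hij)]
    exact Finset.sum_le_sum_of_subset_of_nonneg hsub fun i _ _ => by linarith [hρ (T^[i] y)]
  have hlow : (m : ℝ) * ((a + ρ) * (L * τ)) ≤ ∑ j ∈ Finset.range m, (φ (T^[j * τ] y) + ρ) := by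
    simpa using Finset.card_nsmul_le_sum (Finset.range m) _ _
      fun j hj => h j (Finset.mem_range.1 hj)
  have htotal : ∑ i ∈ Finset.range (L * m * τ), (φ (T^[i] y) + ρ) =
      birkhoff T φ (L * m * τ) y + L * m * τ * ρ := by
    simp [birkhoff, Finset.sum_add_distrib]
  push_cast
  linarith

/-- A sequence decaying exponentially is summable along the times `L ⌊c log n / τ⌋ τ` once `L` is
large enough. -/
theorem exists_summable_comp_mul_floor_log {a : ℕ → ℝ} (ha : ∀ n, 0 ≤ a n) {I : ℝ} (hI : 0 < I)
    (h : Tendsto (fun n : ℕ => Real.log (a n) / n) atTop (nhds (-I)))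
    {c : ℝ} (hc : 0 < c) {τ : ℕ} (hτ : 0 < τ) :
    ∃ L : ℕ, 1 ≤ L ∧ Summable fun n : ℕ => a (L * ⌊c * Real.log n / τ⌋₊ * τ) := by
  obtain ⟨L, hL⟩ := exists_nat_ge (max 1 (4 / (c * I)))
  have hL1 : 1 ≤ L := by exact_mod_cast (le_max_left _ _).trans hL
  have hLc : 4 ≤ L * (c * I) := (div_le_iff₀ (by positivity)).1 ((le_max_right _ _).trans hL)
  have hτ' : (0 : ℝ) < τ := Nat.cast_pos.2 hτ
  refine ⟨L, hL1, ?_⟩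
  have hlog : Tendsto (fun n : ℕ => c * Real.log n / τ) atTop atTop :=
    ((Real.tendsto_log_atTop.comp tendsto_natCast_atTop_atTop).const_mul_atTop hc).atTop_div_const
      hτ'
  have hN : Tendsto (fun n : ℕ => L * ⌊c * Real.log n / τ⌋₊ * τ) atTop atTop :=
    tendsto_atTop_mono
      (fun n => (Nat.le_mul_of_pos_left _ hL1).trans (Nat.le_mul_of_pos_right _ hτ))
      (tendsto_nat_floor_atTop.comp hlog)
  have hdecay : ∀ᶠ k : ℕ in atTop, a k ≤ Real.exp (-(k * I / 2)) := by
    filter_upwards [h.eventually_lt_const (show -I < -(I / 2) by linarith), eventually_gt_atTop 0]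
      with k hk hk0
    have hk0' : (0 : ℝ) < k := Nat.cast_pos.2 hk0
    rcases (ha k).eq_or_lt with h0 | h0
    · rw [← h0]; positivity
    · rw [← Real.log_le_iff_le_exp h0]
      have := (div_lt_iff₀ hk0').1 hk
      linarith
  have hs : Summable fun n : ℕ => Real.exp (L * τ * I / 2) * (1 / (n : ℝ) ^ 2) :=
    (Real.summable_one_div_nat_pow.2 one_lt_two).mul_left _
  refine Summable.of_norm_bounded_eventually_nat hs ?_
  filter_upwards [hN.eventually hdecay, eventually_gt_atTop 0] with n hn hn0
  have hn0' : (0 : ℝ) < n := Nat.cast_pos.2 hn0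
  rw [Real.norm_of_nonneg (ha _)]
  refine hn.trans ?_
  have hsq : 1 / (n : ℝ) ^ 2 = Real.exp (-(2 * Real.log n)) := by
    rw [Real.exp_neg, one_div, ← Real.exp_log (pow_pos hn0' 2), Real.log_pow]
    simp
  rw [hsq, ← Real.exp_add, Real.exp_le_exp]
  have hfl := Nat.lt_floor_add_one (c * Real.log n / τ)
  rw [div_lt_iff₀ hτ'] at hfl
  have hlog0 : 0 ≤ Real.log n := Real.log_natCast_nonneg n
  push_cast
  have h1 : L * I / 2 * (c * Real.log n) ≤
      L * I / 2 * ((⌊c * Real.log n / τ⌋₊ + 1) * τ) := by gcongr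
  nlinarith [mul_le_mul_of_nonneg_right hLc hlog0]

theorem aemeasurable_birkhoff {X : Type*} [MeasurableSpace X] {μ : Measure X} {T : X → X}
    (hT : MeasurePreserving T μ μ) {φ : X → ℝ} (hφ : AEMeasurable φ μ) (n : ℕ) :
    AEMeasurable (birkhoff T φ n) μ :=
  Finset.aemeasurable_fun_sum _ fun i _ =>
    hφ.comp_quasiMeasurePreserving (hT.iterate i).quasiMeasurePreserving

theorem integral_birkhoff {X : Type*} [MeasurableSpace X] {μ : Measure X} {T : X → X}
    (hT : MeasurePreserving T μ μ) {φ : X → ℝ} (hφ : Integrable φ μ) (n : ℕ) :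
    ∫ x, birkhoff T φ n x ∂μ = n * ∫ x, φ x ∂μ := by
  have hi : ∀ i : ℕ, ∫ x, φ (T^[i] x) ∂μ = ∫ x, φ x ∂μ := fun i => by
    have hmap := (hT.iterate i).map_eq
    rw [← integral_map (hT.iterate i).aemeasurable (by rw [hmap]; exact hφ.aestronglyMeasurable),
      hmap]
  unfold birkhoff
  have hint : ∀ i ∈ Finset.range n, Integrable (fun x => φ (T^[i] x)) μ :=
    fun i _ => (hT.iterate i).integrable_comp_of_integrable hφ
  rw [integral_finsetSum _ hint]
  simp [hi]

/-- The Birkhoff sum over a multiple of the period is constant along a periodic orbit. -/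
theorem birkhoff_iterate_of_isPeriodicPt {X : Type*} {T : X → X} {p : X} {N : ℕ}
    (hp : Function.IsPeriodicPt T N p) (φ : X → ℝ) (i : ℕ) :
    birkhoff T φ N (T^[i] p) = birkhoff T φ N p := by
  induction i with
  | zero => rfl
  | succ i ih =>
    rw [← ih, Function.iterate_succ_apply']
    have h := birkhoffSum_apply_sub_birkhoffSum T φ N (T^[i] p)
    rw [(hp.apply_iterate i : T^[N] (T^[i] p) = T^[i] p), sub_self, sub_eq_zero] at h
    exact h

/-- If almost every orbit hits a periodic point, then almost every point lies on its orbit. -/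
theorem ae_mem_orbit_of_ae_hits {X : Type*} [MeasurableSpace X] [MeasurableSingletonClass X]
    {μ : Measure X} [IsFiniteMeasure μ] {T : X → X} (hT : MeasurePreserving T μ μ) {p : X}
    (hits : ∀ᵐ x ∂μ, ∃ k : ℕ, T^[k] x = p) :
    ∀ᵐ x ∂μ, ∃ i : ℕ, T^[i] p = x := by
  set E : Set X := range fun i : ℕ => T^[i] p
  have hE : MeasurableSet E := (countable_range _).measurableSet
  have hinv : ∀ k : ℕ, E ⊆ T^[k] ⁻¹' E := by
    rintro k _ ⟨i, rfl⟩
    exact ⟨k + i, Function.iterate_add_apply T k i p⟩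
  have hnull : ∀ k : ℕ, μ (T^[k] ⁻¹' E \ E) = 0 := fun k => by
    rw [measure_sdiff (hinv k) hE.nullMeasurableSet (measure_ne_top μ E),
      (hT.iterate k).measure_preimage hE.nullMeasurableSet, tsub_self]
  have hae : ∀ᵐ x ∂μ, ∀ k : ℕ, x ∉ T^[k] ⁻¹' E \ E :=
    ae_all_iff.2 fun k => measure_eq_zero_iff_ae_notMem.1 (hnull k)
  filter_upwards [hits, hae] with x ⟨k, hk⟩ hx
  by_contra hxE
  exact hx k ⟨⟨0, hk.symm⟩, hxE⟩

/-- If almost every point lies on a periodic orbit, the mean-zero Birkhoff sums vanish along the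
multiples of the period, so `log 0 / n = 0` is the only possible limit. -/
theorem not_tendsto_log_measure_of_ae_mem_orbit {X : Type*} [MeasurableSpace X] {μ : Measure X}
    [IsProbabilityMeasure μ] {T : X → X} (hT : MeasurePreserving T μ μ) {p : X} {τ : ℕ}
    (hτ : 0 < τ) (hper : T^[τ] p = p) (horbit : ∀ᵐ x ∂μ, ∃ i : ℕ, T^[i] p = x) {φ : X → ℝ}
    (hφint : Integrable φ μ) (hφmean : ∫ x, φ x ∂μ = 0) {a I : ℝ} (ha : 0 < a) (hI : 0 < I) :
    ¬ Tendsto (fun n : ℕ =>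
        Real.log ((μ {x | (n : ℝ) * a ≤ birkhoff T φ n x}).toReal) / (n : ℝ))
      atTop (nhds (-I)) := by
  intro h
  have hzero : ∀ q : ℕ, ∀ᵐ x ∂μ, birkhoff T φ (q * τ) x = 0 := fun q => by
    have hp : Function.IsPeriodicPt T (q * τ) p :=
      Function.IsPeriodicPt.const_mul (show Function.IsPeriodicPt T τ p from hper) q
    have hconst : ∀ᵐ x ∂μ, birkhoff T φ (q * τ) x = birkhoff T φ (q * τ) p := by
      filter_upwards [horbit] with x ⟨i, hi⟩
      rw [← hi, birkhoff_iterate_of_isPeriodicPt hp]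
    have hint := integral_birkhoff hT hφint (q * τ)
    rw [integral_congr_ae hconst, hφmean, mul_zero, integral_const, probReal_univ, one_smul] at hint
    rwa [hint] at hconst
  have hsub := h.comp (tendsto_id.atTop_mul_const' hτ)
  have hlim : Tendsto ((fun n : ℕ =>
      Real.log ((μ {x | (n : ℝ) * a ≤ birkhoff T φ n x}).toReal) / (n : ℝ)) ∘
        fun q : ℕ => id q * τ) atTop (nhds 0) := by
    refine tendsto_const_nhds.congr' ?_
    filter_upwards [eventually_gt_atTop 0] with q hq
    have hqτ : (0 : ℝ) < ((q * τ : ℕ) : ℝ) * a :=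
      mul_pos (Nat.cast_pos.2 (Nat.mul_pos hq hτ)) ha
    have hμ : μ {x | ((q * τ : ℕ) : ℝ) * a ≤ birkhoff T φ (q * τ) x} = 0 := by
      rw [measure_eq_zero_iff_ae_notMem]
      filter_upwards [hzero q] with x hx
      exact fun hle => hqτ.not_ge (hx ▸ hle)
    simp only [Function.comp_apply, id_eq, hμ, ENNReal.toReal_zero, Real.log_zero, zero_div]
  linarith [tendsto_nhds_unique hsub hlim]

/-- Exponential decay of the upper deviations forces almost every orbit to hit `p`: an orbit
coming within `n ^ (-γ)` of `p` at time `n` without hitting it follows the orbit of `p` for a time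
of order `log n`, which makes the Birkhoff sum too large for infinitely many `n`. -/
theorem ae_hits_of_tendsto_log_measure {X : Type*} [MetricSpace X] [MeasurableSpace X]
    {μ : Measure X} [IsProbabilityMeasure μ] {T : X → X} (hT : MeasurePreserving T μ μ)
    {p : X} {τ : ℕ} (hτ : 0 < τ) (hper : T^[τ] p = p)
    {K : ℝ} (hK : 1 < K) {V : Set X} (hVopen : IsOpen V) (horb : ∀ i : ℕ, T^[i] p ∈ V)
    (hLip : ∀ x ∈ V, ∀ y ∈ V, dist (T x) (T y) ≤ K * dist x y)
    {γ : ℝ} (hγ : 0 < γ)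
    (hrec : ∀ᵐ x ∂μ, ∃ᶠ n : ℕ in atTop, dist (T^[n] x) p < (n : ℝ) ^ (-γ))
    {φ : X → ℝ} (hφ : AEMeasurable φ μ)
    (hφblow : Tendsto φ (nhdsWithin p {p}ᶜ) atTop)
    {ρ : ℝ} (hρ : 0 < ρ) (hφbelow : ∀ x, -ρ < φ x) {a I : ℝ} (hI : 0 < I)
    (h : Tendsto (fun n : ℕ =>
        Real.log ((μ {x | (n : ℝ) * a ≤ birkhoff T φ n x}).toReal) / (n : ℝ))
      atTop (nhds (-I))) :
    ∀ᵐ x ∂μ, ∃ k : ℕ, T^[k] x = p := by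
  have hK0 : 0 < K := one_pos.trans hK
  have hlogK : 0 < Real.log K := Real.log_pos hK
  have hτ' : (0 : ℝ) < τ := Nat.cast_pos.2 hτ
  set c : ℝ := γ / (2 * Real.log K) with hc_def
  have hc : 0 < c := by positivity
  obtain ⟨L, hL, hsum⟩ := exists_summable_comp_mul_floor_log (fun _ => ENNReal.toReal_nonneg) hI h
    hc hτ
  set m : ℕ → ℕ := fun n => ⌊c * Real.log n / τ⌋₊
  set A : ℕ → Set X := fun N => {x | (N : ℝ) * a ≤ birkhoff T φ N x}
  have hA : ∀ N, NullMeasurableSet (A N) μ := fun N =>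
    nullMeasurableSet_le aemeasurable_const (aemeasurable_birkhoff hT hφ N)
  have hBC : ∀ᵐ x ∂μ, ∀ᶠ n : ℕ in atTop, x ∉ T^[n] ⁻¹' A (L * m n * τ) := by
    refine ae_eventually_notMem ?_
    have := hsum.tsum_ofReal_ne_top
    convert this using 3 with n
    rw [(hT.iterate n).measure_preimage (hA _), ENNReal.ofReal_toReal (measure_ne_top μ _)]
  obtain ⟨r, hr, hrV⟩ := exists_ball_subset_of_periodic hτ hper hVopen horb
  obtain ⟨δ, hδ, hδφ⟩ := Metric.mem_nhdsWithin_iff.1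
    (hφblow.eventually_ge_atTop ((a + ρ) * (L * τ)))
  have hsmall : ∀ᶠ n : ℕ in atTop, (n : ℝ) ^ (-(γ / 2)) < min r δ :=
    ((tendsto_rpow_neg_atTop (half_pos hγ)).comp tendsto_natCast_atTop_atTop).eventually_lt_const
      (lt_min hr hδ)
  filter_upwards [hrec, hBC] with x hx hxA
  obtain ⟨n, hdist, hnA, hn, hn0⟩ :=
    (hx.and_eventually (hxA.and (hsmall.and (eventually_gt_atTop 0)))).exists
  have hn0' : (0 : ℝ) < n := Nat.cast_pos.2 hn0
  by_contra! hmiss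
  refine hnA (mul_le_birkhoff_of_large_along_period (fun x => (hφbelow x).le) hτ hL (m n) _
    fun j hj => ?_)
  have hjτ : ((j * τ : ℕ) : ℝ) * Real.log K ≤ γ / 2 * Real.log n := by
    have h1 : ((j : ℕ) : ℝ) ≤ c * Real.log n / τ :=
      (Nat.cast_le.2 hj.le).trans (Nat.floor_le (by
        have := Real.log_natCast_nonneg n
        positivity))
    rw [le_div_iff₀ hτ'] at h1
    push_cast
    calc (j : ℝ) * τ * Real.log K ≤ c * Real.log n * Real.log K := by gcongr
      _ = γ / 2 * Real.log n := by rw [hc_def]; field_simp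
  have hpow : K ^ (j * τ) ≤ (n : ℝ) ^ (γ / 2) := by
    rw [← Real.log_le_log_iff (by positivity) (by positivity), Real.log_pow, Real.log_rpow hn0']
    exact hjτ
  have hclose : K ^ (j * τ) * dist (T^[n] x) p < min r δ := by
    refine lt_of_le_of_lt ?_ hn
    calc K ^ (j * τ) * dist (T^[n] x) p ≤ (n : ℝ) ^ (γ / 2) * (n : ℝ) ^ (-γ) := by gcongr
      _ = (n : ℝ) ^ (-(γ / 2)) := by rw [← Real.rpow_add hn0']; ring_nf
  have hd := dist_iterate_le_pow_mul_dist hK.le hr hrV hLip (j * τ)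
    (hclose.trans_le (min_le_left _ _))
  have hpj : T^[j * τ] p = p :=
    Function.IsPeriodicPt.const_mul (show Function.IsPeriodicPt T τ p from hper) j
  rw [hpj] at hd
  have hne : T^[j * τ] (T^[n] x) ≠ p := by
    rw [← Function.iterate_add_apply]
    exact hmiss _
  have hbig : (a + ρ) * (L * τ) ≤ φ (T^[j * τ] (T^[n] x)) :=
    hδφ ⟨hd.trans_lt (hclose.trans_le (min_le_right _ _)), hne⟩
  linarith

/-- On a compact metric space, if `T` preserves `μ`, is locally Lipschitz (constant `K`)
on an open neighborhood of the orbit of a periodic point `p`, and a.e. orbit enters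
`B(p, n^{-γ})` infinitely often, then a continuous observable blowing up to `+∞` at `p`,
of mean zero and bounded below, admits no exponential large deviations rate function. -/
theorem no_rate_function_for_unbounded_observable
    {X : Type*} [MetricSpace X] [CompactSpace X]
    [MeasurableSpace X] [BorelSpace X]
    (μ : Measure X) [IsProbabilityMeasure μ]
    (T : X → X) (hT : MeasurePreserving T μ μ)
    (p : X) (τ : ℕ) (hτ : 0 < τ) (hper : T^[τ] p = p)
    (K : ℝ) (hK : 1 < K) (V : Set X) (hVopen : IsOpen V) (horb : ∀ i : ℕ, T^[i] p ∈ V)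
    (hLip : ∀ x ∈ V, ∀ y ∈ V, dist (T x) (T y) ≤ K * dist x y)
    (γ : ℝ) (hγ : 0 < γ)
    (hrec : ∀ᵐ x ∂μ, ∃ᶠ n : ℕ in atTop, dist (T^[n] x) p < (n : ℝ) ^ (-γ))
    (φ : X → ℝ) (hφcont : ContinuousOn φ {p}ᶜ)
    (hφblow : Tendsto φ (nhdsWithin p {p}ᶜ) atTop)
    (hφint : Integrable φ μ) (hφmean : ∫ x, φ x ∂μ = 0)
    (ρ : ℝ) (hρ : 0 < ρ) (hφbelow : ∀ x, -ρ < φ x) :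
    ¬ HasRateFunction μ T φ := by
  rintro ⟨U, I, hU, h0, -, hI0, hIz, hpos, -⟩
  obtain ⟨ε, hε, hεU⟩ := Metric.isOpen_iff.1 hU 0 h0
  have haU : ε / 2 ∈ U := hεU (by
    rw [Metric.mem_ball, dist_zero_right, Real.norm_of_nonneg (half_pos hε).le]
    exact half_lt_self hε)
  have hI : 0 < I (ε / 2) :=
    (hI0 _ haU).lt_of_ne' fun h => (half_pos hε).ne' ((hIz _ haU).1 h)
  have hlim := hpos _ haU (half_pos hε)
  have hits := ae_hits_of_tendsto_log_measure hT hτ hper hK hVopen horb hLip hγ hrec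
    hφint.aemeasurable hφblow hρ hφbelow hI hlim
  exact not_tendsto_log_measure_of_ae_mem_orbit hT hτ hper (ae_mem_orbit_of_ae_hits hT hits)
    hφint hφmean (half_pos hε) hI hlim
end

section
/- Let T : [0,1] → [0,1] preserve a Borel probability measure μ that is absolutely continuous with respect to Lebesgue measure with density bounded above by M < ∞. Let p ∈ [0,1] be a fixed point, α > 0, φ(x) := (−log|x − p|)^α, assumed μ-integrable with mean φ̄ := ∫ φ dμ > 0. Set β := 1/(1+α), g_n := φ·1_{{x : |x−p| > e^{−n^β}}}, and G_n := Σ_{j=1}^{n} g_n∘T^j with E_n := ∫ G_n dμ. Assume the Schindler-type concentration estimate: with ζ_n := 1/log log n, for every ε > 0 there exists N such that for all n ≥ N, μ( |G_n − E_n| > ε E_n ) ≤ 2 exp( −ζ_n · n · (∫ g_n dμ) / n^{βα} ). Then for every ε > 0 and every δ > 0 there exists C > 0 such that for all n: μ( |S_n(φ) − n φ̄| ≥ n ε ) ≤ C · exp(−n^{1/(1+α) − δ}). -/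
open MeasureTheory Filter Set
open scoped ENNReal

/-- A real power divided by an iterated logarithm eventually dominates every smaller power. -/
lemma eventually_rpow_sub_le_div_log_log {c β δ : ℝ} (hc : 0 < c) (hδ : 0 < δ) :
    ∀ᶠ n : ℕ in atTop,
      (n : ℝ) ^ (β - δ) ≤ 1 / Real.log (Real.log n) * (c * (n : ℝ) ^ β) := by
  have hlog : ∀ᶠ x : ℝ in atTop, ‖Real.log x‖ ≤ c * ‖x ^ δ‖ :=
    (isLittleO_log_rpow_atTop hδ).bound hc
  have hloglog : Tendsto (fun x : ℝ => Real.log (Real.log x)) atTop atTop :=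
    Real.tendsto_log_atTop.comp Real.tendsto_log_atTop
  filter_upwards [tendsto_natCast_atTop_atTop.eventually hlog,
    tendsto_natCast_atTop_atTop.eventually (hloglog.eventually_gt_atTop 0),
    tendsto_natCast_atTop_atTop.eventually (Real.tendsto_log_atTop.eventually_gt_atTop 0),
    eventually_gt_atTop 0] with n h₁ h₂ h₃ h₄
  have hn : (0 : ℝ) < n := by exact_mod_cast h₄
  have hle : Real.log (Real.log n) ≤ c * (n : ℝ) ^ δ := by
    rw [Real.norm_of_nonneg h₃.le, Real.norm_of_nonneg (by positivity)] at h₁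
    linarith [Real.log_le_sub_one_of_pos h₃]
  rw [one_div, inv_mul_eq_div, le_div_iff₀ h₂]
  calc (n : ℝ) ^ (β - δ) * Real.log (Real.log n)
      ≤ (n : ℝ) ^ (β - δ) * (c * (n : ℝ) ^ δ) := by gcongr
    _ = c * (n : ℝ) ^ β := by
      rw [mul_left_comm, ← Real.rpow_add hn, sub_add_cancel]

/-- A linear factor is absorbed by lowering the exponent of a stretched exponential. -/
lemma eventually_mul_exp_neg_rpow_le {β δ : ℝ} (hβ : 0 < β) (hδ : 0 < δ) :
    ∀ᶠ n : ℕ in atTop,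
      (n : ℝ) * Real.exp (-(n : ℝ) ^ β) ≤ Real.exp (-(n : ℝ) ^ (β - δ)) := by
  have hlog : ∀ᶠ x : ℝ in atTop, ‖Real.log x‖ ≤ 1 / 2 * ‖x ^ β‖ :=
    (isLittleO_log_rpow_atTop hβ).bound (by norm_num)
  have hpow : ∀ᶠ x : ℝ in atTop, (2 : ℝ) ≤ x ^ δ :=
    (tendsto_rpow_atTop hδ).eventually_ge_atTop 2
  filter_upwards [tendsto_natCast_atTop_atTop.eventually hlog,
    tendsto_natCast_atTop_atTop.eventually hpow, eventually_gt_atTop 0] with n h₁ h₂ h₃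
  have hn : (0 : ℝ) < n := by exact_mod_cast h₃
  rw [Real.norm_of_nonneg (by positivity : (0 : ℝ) ≤ (n : ℝ) ^ β)] at h₁
  have hsplit : (n : ℝ) ^ β = (n : ℝ) ^ (β - δ) * (n : ℝ) ^ δ := by
    rw [← Real.rpow_add hn, sub_add_cancel]
  have hhalf : 2 * (n : ℝ) ^ (β - δ) ≤ (n : ℝ) ^ β := by
    rw [hsplit, mul_comm]
    gcongr
  calc (n : ℝ) * Real.exp (-(n : ℝ) ^ β)
      = Real.exp (Real.log n + -(n : ℝ) ^ β) := by rw [Real.exp_add, Real.exp_log hn]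
    _ ≤ Real.exp (-(n : ℝ) ^ (β - δ)) := by
      gcongr
      linarith [(le_abs_self _).trans h₁]

/-- An eventual bound by a positive sequence is a global one, after enlarging the constant. -/
lemma exists_pos_forall_le_mul_of_eventually_le {a b : ℕ → ℝ} {K : ℝ} (ha : ∀ n, 0 ≤ a n)
    (hb : ∀ n, 0 < b n) (h : ∀ᶠ n in atTop, a n ≤ K * b n) :
    ∃ C > 0, ∀ n, a n ≤ C * b n := by
  have hO : a =O[atTop] b := by
    refine Asymptotics.IsBigO.of_bound K (h.mono fun n hn => ?_)
    rwa [Real.norm_of_nonneg (ha n), Real.norm_of_nonneg (hb n).le]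
  obtain ⟨C, hC, hCb⟩ := Asymptotics.bound_of_isBigO_nat_atTop hO
  refine ⟨C, hC, fun n => ?_⟩
  simpa [Real.norm_of_nonneg (ha n), Real.norm_of_nonneg (hb n).le] using hCb (hb n).ne'

lemma measureReal_abs_sub_le_of_le_smul_volume {μ : Measure ℝ} {M : ℝ} (hM : 0 ≤ M)
    (hdens : μ ≤ (ENNReal.ofReal M) • (volume : Measure ℝ)) (p : ℝ) {r : ℝ} (hr : 0 ≤ r) :
    μ.real {x | |x - p| ≤ r} ≤ 2 * M * r := by
  have hball : {x : ℝ | |x - p| ≤ r} = Metric.closedBall p r := by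
    ext x
    simp [Real.dist_eq]
  rw [hball]
  refine ENNReal.toReal_le_of_le_ofReal (by positivity) ((hdens _).trans_eq ?_)
  rw [Measure.smul_apply, Real.volume_closedBall, smul_eq_mul, ← ENNReal.ofReal_mul hM]
  congr 1
  ring

lemma MeasureTheory.MeasurePreserving.integral_comp_of_integrable {X : Type*} [MeasurableSpace X]
    {μ : Measure X} {T : X → X} (hT : MeasurePreserving T μ μ) {f : X → ℝ}
    (hf : Integrable f μ) : ∫ x, f (T x) ∂μ = ∫ x, f x ∂μ := by
  have hf' : AEStronglyMeasurable f (μ.map T) := by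
    rw [hT.map_eq]
    exact hf.aestronglyMeasurable
  rw [← integral_map hT.aemeasurable hf', hT.map_eq]

lemma measurable_birkhoff {X : Type*} [MeasurableSpace X] {T : X → X} {φ : X → ℝ}
    (hT : Measurable T) (hφ : Measurable φ) (n : ℕ) : Measurable (birkhoff T φ n) := by
  unfold birkhoff
  exact Finset.measurable_sum _ fun i _ => hφ.comp (hT.iterate i)

/-- If `g` agrees with `φ` off `B`, then the Birkhoff sums of `φ` and `g` can only differ on
orbits visiting `B`, so deviation probabilities for `φ` are controlled by those for `g`. -/
lemma measureReal_birkhoff_le_add {X : Type*} [MeasurableSpace X] {μ : Measure X}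
    [IsProbabilityMeasure μ] {T : X → X} (hT : MeasurePreserving T μ μ) {φ g : X → ℝ}
    (hφ : Measurable φ) {B : Set X} (hB : MeasurableSet B) (hgφ : ∀ x ∉ B, g x = φ x) (n : ℕ)
    {s : Set ℝ} (hs : MeasurableSet s) :
    μ.real {x | birkhoff T φ n x ∈ s} ≤
      μ.real {x | birkhoff T g n (T x) ∈ s} + n * μ.real B := by
  have hmeas : MeasurableSet {x | birkhoff T φ n x ∈ s} :=
    measurable_birkhoff hT.measurable hφ n hs
  rw [← hT.measureReal_preimage hmeas.nullMeasurableSet]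
  have hsub : T ⁻¹' {x | birkhoff T φ n x ∈ s} ⊆
      {x | birkhoff T g n (T x) ∈ s} ∪ ⋃ j ∈ Finset.range n, T^[j + 1] ⁻¹' B := by
    intro x hx
    by_cases hbad : ∃ j ∈ Finset.range n, T^[j + 1] x ∈ B
    · obtain ⟨j, hj, hjB⟩ := hbad
      exact Or.inr (mem_biUnion hj hjB)
    · push Not at hbad
      have heq : birkhoff T g n (T x) = birkhoff T φ n (T x) :=
        Finset.sum_congr rfl fun j hj => hgφ _ (hbad j hj)
      left
      rw [mem_ofPred_eq, heq]
      exact hx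
  calc μ.real (T ⁻¹' {x | birkhoff T φ n x ∈ s})
      ≤ μ.real {x | birkhoff T g n (T x) ∈ s} +
          μ.real (⋃ j ∈ Finset.range n, T^[j + 1] ⁻¹' B) :=
        (measureReal_mono hsub).trans (measureReal_union_le _ _)
    _ ≤ μ.real {x | birkhoff T g n (T x) ∈ s} +
          ∑ j ∈ Finset.range n, μ.real (T^[j + 1] ⁻¹' B) := by
        gcongr
        exact measureReal_biUnion_finset_le _ _
    _ = μ.real {x | birkhoff T g n (T x) ∈ s} + n * μ.real B := by
        simp [(hT.iterate _).measureReal_preimage hB.nullMeasurableSet, -Function.iterate_succ]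

/-- Truncating `φ` on balls around `p` of radius tending to `0` does not change its integral in
the limit, provided that `φ p = 0`. -/
lemma tendsto_integral_truncation {μ : Measure ℝ} {φ : ℝ → ℝ} {p : ℝ} (hφ : Measurable φ)
    (hφp : φ p = 0) (hφint : Integrable φ μ) {r : ℕ → ℝ} (hr : Tendsto r atTop (nhds 0)) :
    Tendsto (fun n => ∫ x, (if r n < |x - p| then φ x else 0) ∂μ) atTop
      (nhds (∫ x, φ x ∂μ)) := by
  refine tendsto_integral_of_dominated_convergence (fun x => ‖φ x‖) (fun n => ?_) hφint.norm
    (fun n => ?_) ?_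
  · exact (Measurable.ite (measurableSet_lt measurable_const (by fun_prop)) hφ
      measurable_const).aestronglyMeasurable
  · refine Eventually.of_forall fun x => ?_
    split_ifs <;> simp
  · refine Eventually.of_forall fun x => ?_
    refine tendsto_const_nhds.congr' ?_
    rcases eq_or_ne x p with rfl | hx
    · simp [hφp]
    · filter_upwards [hr.eventually_lt_const (abs_pos.2 (sub_ne_zero.2 hx))] with n hn
      rw [if_pos hn]

/-- Stretched exponential upper bound for `φ(x) = (−log|x−p|)^α` via truncation and a
Schindler-type concentration estimate: for every `ε, δ > 0` there is `C > 0` with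
`μ(|S_n(φ) − nφ̄| ≥ nε) ≤ C·exp(−n^{1/(1+α)−δ})`. -/
theorem stretched_exponential_upper_bound
    (T : ℝ → ℝ) (hmaps : Set.MapsTo T (Set.Icc (0 : ℝ) 1) (Set.Icc (0 : ℝ) 1))
    (μ : Measure ℝ) [IsProbabilityMeasure μ] (hsupp : μ (Set.Icc (0 : ℝ) 1)ᶜ = 0)
    (hT : MeasurePreserving T μ μ)
    (M : ℝ) (hM : 0 < M) (hdens : μ ≤ (ENNReal.ofReal M) • (MeasureTheory.volume : Measure ℝ))
    (p : ℝ) (hp : p ∈ Set.Icc (0 : ℝ) 1) (hfix : T p = p)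
    (α : ℝ) (hα : 0 < α)
    (φ : ℝ → ℝ) (hφ : ∀ x, φ x = (-Real.log |x - p|) ^ α)
    (hφint : Integrable φ μ)
    (φbar : ℝ) (hφbar : φbar = ∫ x, φ x ∂μ) (hφbarpos : 0 < φbar)
    (β : ℝ) (hβ : β = 1 / (1 + α))
    (g : ℕ → ℝ → ℝ)
    (hg : ∀ n x, g n x = if Real.exp (-(n : ℝ) ^ β) < |x - p| then φ x else 0)
    (G : ℕ → ℝ → ℝ) (hG : ∀ n x, G n x = ∑ j ∈ Finset.range n, g n (T^[j + 1] x))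
    (E : ℕ → ℝ) (hE : ∀ n, E n = ∫ x, G n x ∂μ)
    (ζ : ℕ → ℝ) (hζ : ∀ n, ζ n = 1 / Real.log (Real.log n))
    (hschindler : ∀ ε > (0 : ℝ), ∃ N : ℕ, ∀ n ≥ N,
      (μ {x | ε * E n < |G n x - E n|}).toReal ≤
        2 * Real.exp (-(ζ n) * (n : ℝ) * (∫ x, g n x ∂μ) / (n : ℝ) ^ (β * α))) :
    ∀ ε > (0 : ℝ), ∀ δ > (0 : ℝ), ∃ C > (0 : ℝ), ∀ n : ℕ,
      (μ {x | (n : ℝ) * ε ≤ |birkhoff T φ n x - (n : ℝ) * φbar|}).toReal ≤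
        C * Real.exp (-(n : ℝ) ^ ((1 : ℝ) / (1 + α) - δ)) := by
  intro ε hε δ hδ
  have hβpos : 0 < β := by rw [hβ]; positivity
  rw [← hβ]
  have hφmeas : Measurable φ := by
    rw [funext hφ]
    fun_prop
  have hφp : φ p = 0 := by simp [hφ, Real.zero_rpow hα.ne']
  have hgint : ∀ n, Integrable (g n) μ := fun n => by
    have hind : g n = {x | Real.exp (-(n : ℝ) ^ β) < |x - p|}.indicator φ := by
      ext x
      simp [hg, indicator_apply]
    rw [hind]
    exact hφint.indicator (measurableSet_lt measurable_const (by fun_prop))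
  have hGb : ∀ n x, G n x = birkhoff T (g n) n (T x) := hG
  have hEn : ∀ n, E n = n * ∫ x, g n x ∂μ := fun n => by
    simp_rw [hE, hG]
    have hcomp : ∀ j ∈ Finset.range n, Integrable (fun x => g n (T^[j + 1] x)) μ := fun j _ =>
      (hT.iterate (j + 1)).integrable_comp_of_integrable (hgint n)
    rw [integral_finsetSum _ hcomp]
    simp [(hT.iterate _).integral_comp_of_integrable (hgint n), -Function.iterate_succ]
  have hrad : Tendsto (fun n : ℕ => Real.exp (-(n : ℝ) ^ β)) atTop (nhds 0) :=
    Real.tendsto_exp_neg_atTop_nhds_zero.comp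
      ((tendsto_rpow_atTop hβpos).comp tendsto_natCast_atTop_atTop)
  have hmean : Tendsto (fun n => ∫ x, g n x ∂μ) atTop (nhds φbar) := by
    simp_rw [hg, hφbar]
    exact tendsto_integral_truncation hφmeas hφp hφint hrad
  obtain ⟨N, hN⟩ := hschindler (ε / (8 * φbar)) (by positivity)
  refine exists_pos_forall_le_mul_of_eventually_le (K := 2 + 2 * M)
    (fun n => ENNReal.toReal_nonneg) (fun n => Real.exp_pos _) ?_
  filter_upwards [eventually_ge_atTop N, eventually_gt_atTop 0,
    hmean.eventually (Metric.ball_mem_nhds _ (half_pos hφbarpos)),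
    hmean.eventually (Metric.ball_mem_nhds _ (half_pos hε)),
    eventually_rpow_sub_le_div_log_log (β := β) (half_pos hφbarpos) hδ,
    (Real.tendsto_log_atTop.comp (Real.tendsto_log_atTop.comp
      tendsto_natCast_atTop_atTop)).eventually_gt_atTop 0,
    eventually_mul_exp_neg_rpow_le hβpos hδ] with n hnN hn hφb hεb hll hllpos hexp
  have hn' : (0 : ℝ) < n := by exact_mod_cast hn
  rw [Real.dist_eq, abs_lt] at hφb hεb
  have htrunc := measureReal_birkhoff_le_add hT hφmeas (g := g n)
    (B := {x | |x - p| ≤ Real.exp (-(n : ℝ) ^ β)})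
    (measurableSet_le (by fun_prop) measurable_const)
    (fun x hx => by rw [hg, if_pos (not_le.1 hx)]) n
    (s := {y | (n : ℝ) * ε ≤ |y - n * φbar|})
    (measurableSet_le measurable_const (by fun_prop))
  have hball := measureReal_abs_sub_le_of_le_smul_volume hM.le hdens p
    (Real.exp_pos (-(n : ℝ) ^ β)).le
  have hdev : μ.real {x | birkhoff T (g n) n (T x) ∈ {y | (n : ℝ) * ε ≤ |y - n * φbar|}} ≤
      μ.real {x | ε / (8 * φbar) * E n < |G n x - E n|} := by
    refine measureReal_mono fun x hx => ?_
    simp only [mem_ofPred_eq, ← hGb] at hx ⊢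
    have hshift : |E n - n * φbar| ≤ n * (ε / 2) := by
      rw [hEn, ← mul_sub, abs_mul, abs_of_pos hn']
      gcongr
      exact abs_le.2 ⟨hεb.1.le, hεb.2.le⟩
    have hsmall : ε / (8 * φbar) * E n ≤ n * (ε / 4) := by
      calc ε / (8 * φbar) * E n ≤ ε / (8 * φbar) * (n * (2 * φbar)) := by
            rw [hEn]
            gcongr
            linarith
        _ = n * (ε / 4) := by
            field_simp
            norm_num
    have htri := abs_sub_le (G n x) (E n) (n * φbar)
    nlinarith [mul_pos hn' hε]
  have hconc : μ.real {x | ε / (8 * φbar) * E n < |G n x - E n|} ≤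
      2 * Real.exp (-(n : ℝ) ^ (β - δ)) := by
    refine (hN n hnN).trans ?_
    gcongr
    have hpow : (n : ℝ) / (n : ℝ) ^ (β * α) = (n : ℝ) ^ β := by
      have hexponent : β = 1 - β * α := by
        rw [hβ]
        field_simp
        ring
      conv_rhs => rw [hexponent, Real.rpow_sub hn', Real.rpow_one]
    have hrate : -(ζ n) * (n : ℝ) * (∫ x, g n x ∂μ) / (n : ℝ) ^ (β * α) =
        -(1 / Real.log (Real.log n) * ((∫ x, g n x ∂μ) * (n : ℝ) ^ β)) := by
      rw [hζ, ← hpow]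
      ring
    rw [hrate, neg_le_neg_iff]
    refine hll.trans ?_
    have hζpos : 0 ≤ 1 / Real.log (Real.log n) := one_div_nonneg.2 hllpos.le
    gcongr
    linarith
  calc μ.real {x | (n : ℝ) * ε ≤ |birkhoff T φ n x - (n : ℝ) * φbar|}
      ≤ 2 * Real.exp (-(n : ℝ) ^ (β - δ)) + n * (2 * M * Real.exp (-(n : ℝ) ^ β)) := by
        refine htrunc.trans (add_le_add (hdev.trans hconc) ?_)
        gcongr
    _ = 2 * Real.exp (-(n : ℝ) ^ (β - δ)) + 2 * M * (n * Real.exp (-(n : ℝ) ^ β)) := by ring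
    _ ≤ 2 * Real.exp (-(n : ℝ) ^ (β - δ)) + 2 * M * Real.exp (-(n : ℝ) ^ (β - δ)) := by gcongr
    _ = (2 + 2 * M) * Real.exp (-(n : ℝ) ^ (β - δ)) := by ring
end

section
/- Let T : [0,1] → [0,1] be measurable and μ a T-invariant Borel probability measure, absolutely continuous with respect to Lebesgue measure with density bounded above. Let P : L¹(μ) → L¹(μ) be the transfer operator of T with respect to μ, and assume there are constants C_P > 0 and 0 < ρ < 1 such that for all f of bounded variation on [0,1] with ∫ f dμ = 0 and all n ≥ 0, |P^n f|_∞ ≤ C_P ρ^n ‖f‖_BV. Fix z ∈ [0,1], α > 0, and let φ(x) := (−log|x − z|)^α with φ̄ := ∫ φ dμ. Then φ has exponential decay of autocorrelations: for every β < min{−log ρ, 1/2} there exists a constant C_β > 0 such that for all n ≥ 0, | ∫ (φ∘T^n − φ̄)(φ − φ̄) dμ | ≤ C_β e^{−β n}. -/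
open MeasureTheory Filter Set
open scoped ENNReal

/-- Sup norm over `[0,1]`. -/
noncomputable def supNormIcc (f : ℝ → ℝ) : ℝ := ⨆ x : Set.Icc (0 : ℝ) 1, |f x.1|

/-- The BV norm `‖f‖_BV = var(f) + |f|_∞` on `[0,1]`. -/
noncomputable def bvNorm (f : ℝ → ℝ) : ℝ :=
  (eVariationOn f (Set.Icc (0 : ℝ) 1)).toReal + supNormIcc f

/-- A dual `Q` of composition with `T` has iterates dual to the iterates of `T` along a centred
function `f`, as long as these iterates stay bounded: either all correlations of `f` with functions
of `T^[n]` vanish, or `Q^[n] f` is integrable and satisfies the duality relation. -/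
lemma iterate_dual_or_eq_zero
    {T : ℝ → ℝ} (hmeas : Measurable T) {μ : Measure ℝ} [IsProbabilityMeasure μ] {s : Set ℝ}
    (hs : ∀ᵐ x ∂μ, x ∈ s) {Q : (ℝ → ℝ) → (ℝ → ℝ)}
    (hdual : ∀ f g : ℝ → ℝ, Integrable f μ → Measurable g → (∃ B : ℝ, ∀ x, |g x| ≤ B) →
      ∫ x, Q f x * g x ∂μ = ∫ x, f x * g (T x) ∂μ)
    {f : ℝ → ℝ} (hf : Integrable f μ) (hf0 : ∫ x, f x ∂μ = 0)
    (hbound : ∀ n : ℕ, ∃ B : ℝ, ∀ x ∈ s, |(Q^[n] f) x| ≤ B) (n : ℕ) :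
    (∀ g : ℝ → ℝ, Measurable g → (∃ B : ℝ, ∀ x, |g x| ≤ B) → ∫ x, f x * g (T^[n] x) ∂μ = 0) ∨
    (Integrable (Q^[n] f) μ ∧
      ∀ g : ℝ → ℝ, Measurable g → (∃ B : ℝ, ∀ x, |g x| ≤ B) →
        ∫ x, (Q^[n] f) x * g x ∂μ = ∫ x, f x * g (T^[n] x) ∂μ) := by
  induction n with
  | zero => exact Or.inr ⟨by simpa using hf, fun g _ _ => by simp⟩
  | succ n ih =>
    rcases ih with h | ⟨hint, hd⟩
    · left
      rintro g hg ⟨B, hB⟩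
      simpa only [Function.iterate_succ_apply'] using
        h (fun x => g (T x)) (hg.comp hmeas) ⟨B, fun x => hB _⟩
    · have key : ∀ g : ℝ → ℝ, Measurable g → (∃ B : ℝ, ∀ x, |g x| ≤ B) →
          ∫ x, (Q^[n+1] f) x * g x ∂μ = ∫ x, f x * g (T^[n+1] x) ∂μ := by
        rintro g hg ⟨B, hB⟩
        simp only [Function.iterate_succ_apply']
        rw [hdual _ g hint hg ⟨B, hB⟩]
        exact hd (fun x => g (T x)) (hg.comp hmeas) ⟨B, fun x => hB _⟩
      by_cases hz : ∀ g : ℝ → ℝ, Measurable g → (∃ B : ℝ, ∀ x, |g x| ≤ B) →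
          ∫ x, f x * g (T^[n+1] x) ∂μ = 0
      · exact Or.inl hz
      · right
        refine ⟨?_, key⟩
        push Not at hz
        obtain ⟨g, hg, ⟨B, hB⟩, hne⟩ := hz
        have hpos : ∀ x, 0 < g x + (B + 1) := fun x => by
          have := neg_abs_le (g x)
          linarith [hB x]
        have hg' : Measurable fun x => g x + (B + 1) := hg.add_const _
        have hfg : Integrable (fun x => f x * g (T^[n+1] x)) μ :=
          hf.mul_bdd (c := B) (hg.comp (hmeas.iterate _)).aestronglyMeasurable
            (Eventually.of_forall fun x => by simpa using hB _)
        have hne' : ∫ x, (Q^[n+1] f) x * (g x + (B + 1)) ∂μ ≠ 0 := by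
          rw [key _ hg' ⟨B + |B + 1|, fun x => (abs_add_le _ _).trans (by linarith [hB x])⟩]
          simp only [mul_add _ (g _)]
          rw [integral_add hfg (hf.mul_const _), integral_mul_const, hf0]
          simpa using hne
        have hint' := Integrable.of_integral_ne_zero hne'
        have haesm : AEStronglyMeasurable (Q^[n+1] f) μ := by
          refine (hint'.aestronglyMeasurable.mul
            hg'.inv.aestronglyMeasurable).congr (Eventually.of_forall fun x => ?_)
          simp only [Pi.mul_apply, Pi.inv_apply]
          field_simp [(hpos x).ne']
        obtain ⟨B', hB'⟩ := hbound (n + 1)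
        exact Integrable.of_bound haesm B' (hs.mono fun x hx => hB' x hx)

/-- Correlations of a centred function with bounded functions of `T^[n]` are controlled by the sup
norm of the `n`-th iterate of the transfer operator. -/
lemma abs_integral_mul_comp_iterate_le
    {T : ℝ → ℝ} (hmeas : Measurable T) {μ : Measure ℝ} [IsProbabilityMeasure μ] {s : Set ℝ}
    (hs : ∀ᵐ x ∂μ, x ∈ s) {Q : (ℝ → ℝ) → (ℝ → ℝ)}
    (hdual : ∀ f g : ℝ → ℝ, Integrable f μ → Measurable g → (∃ B : ℝ, ∀ x, |g x| ≤ B) →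
      ∫ x, Q f x * g x ∂μ = ∫ x, f x * g (T x) ∂μ)
    {f : ℝ → ℝ} (hf : Integrable f μ) (hf0 : ∫ x, f x ∂μ = 0) {b : ℕ → ℝ}
    (hb0 : ∀ n, 0 ≤ b n)
    (hbound : ∀ n : ℕ, ∀ x ∈ s, |(Q^[n] f) x| ≤ b n) {g : ℝ → ℝ} (hg : Measurable g)
    {K : ℝ} (hK0 : 0 ≤ K) (hK : ∀ x, |g x| ≤ K) (n : ℕ) :
    |∫ x, f x * g (T^[n] x) ∂μ| ≤ b n * K := by
  rcases iterate_dual_or_eq_zero hmeas hs hdual hf hf0 (fun n => ⟨b n, hbound n⟩) n with h | h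
  · rw [h g hg ⟨K, hK⟩, abs_zero]
    exact mul_nonneg (hb0 n) hK0
  · rw [← h.2 g hg ⟨K, hK⟩]
    have := norm_integral_le_of_norm_le_const (μ := μ) (f := fun x => (Q^[n] f) x * g x)
      (C := b n * K) (hs.mono fun x hx => by
        rw [norm_mul]
        exact mul_le_mul (hbound n x hx) (hK x) (abs_nonneg _) (hb0 n))
    simpa using this

/-- A unimodal function of the distance to `z` with values in `[c, c + K]` has variation at most
`2K` on `[0,1]`. -/
lemma eVariationOn_comp_dist_le {G : ℝ → ℝ} (hG : Antitone G) {c K : ℝ}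
    (hc : ∀ u, c ≤ G u) (hK : ∀ u, G u ≤ c + K) {z : ℝ} (hz : z ∈ Set.Icc (0 : ℝ) 1) :
    eVariationOn (fun x => G |x - z|) (Set.Icc (0 : ℝ) 1) ≤ ENNReal.ofReal (2 * K) := by
  have hK0 : 0 ≤ K := by linarith [hc 0, hK 0]
  have h1 : eVariationOn (fun x => G |x - z|) (Set.Icc 0 z) ≤ ENNReal.ofReal K := by
    have hm : MonotoneOn (fun x => G |x - z|) (Set.Icc 0 z) := fun x hx y hy hxy => by
      refine hG ?_
      rw [abs_of_nonpos (sub_nonpos.2 hx.2), abs_of_nonpos (sub_nonpos.2 hy.2)]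
      linarith
    have := hm.eVariationOn_eq (Set.left_mem_Icc.2 hz.1) (Set.right_mem_Icc.2 hz.1)
    rw [Set.inter_self] at this
    refine this.trans_le (ENNReal.ofReal_le_ofReal ?_)
    linarith [hc |0 - z|, hK |z - z|]
  have h2 : eVariationOn (fun x => G |x - z|) (Set.Icc z 1) ≤ ENNReal.ofReal K := by
    have hm : MonotoneOn (fun x => -G |x - z|) (Set.Icc z 1) := fun x hx y hy hxy => by
      refine neg_le_neg (hG ?_)
      rw [abs_of_nonneg (sub_nonneg.2 hx.1), abs_of_nonneg (sub_nonneg.2 hy.1)]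
      linarith
    have hneg : eVariationOn (fun x => G |x - z|) (Set.Icc z 1)
        = eVariationOn (fun x => -G |x - z|) (Set.Icc z 1) := by
      simp only [eVariationOn, edist_neg_neg]
    have := hm.eVariationOn_eq (Set.left_mem_Icc.2 hz.2) (Set.right_mem_Icc.2 hz.2)
    rw [Set.inter_self] at this
    refine (hneg.trans this).trans_le (ENNReal.ofReal_le_ofReal ?_)
    linarith [hc |1 - z|, hK |z - z|]
  have := eVariationOn.Icc_add_Icc (fun x => G |x - z|) (s := Set.univ) hz.1 hz.2 (mem_univ z)
  simp only [Set.univ_inter] at this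
  rw [← this, two_mul, ENNReal.ofReal_add hK0 hK0]
  exact add_le_add h1 h2

lemma integrable_abs_sub_rpow {μ : Measure ℝ} (hsupp : μ (Set.Icc (0 : ℝ) 1)ᶜ = 0) {M : ℝ}
    (hdens : μ ≤ (ENNReal.ofReal M) • (MeasureTheory.volume : Measure ℝ))
    {z : ℝ} (hz : z ∈ Set.Icc (0 : ℝ) 1) {r : ℝ} (hr : -1 < r) :
    Integrable (fun x => |x - z| ^ r) μ := by
  have h1 : IntervalIntegrable (fun x : ℝ => |x| ^ r) volume 0 1 :=
    (intervalIntegral.intervalIntegrable_rpow' hr).congr fun x hx => by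
      rw [Set.uIoc_of_le zero_le_one] at hx
      simp only [abs_of_pos hx.1]
  have h2 : IntervalIntegrable (fun x : ℝ => |x| ^ r) volume (-1) 0 := by
    simpa using (IntervalIntegrable.iff_comp_neg (by finiteness)).1 h1.symm
  have h3 := (h2.trans h1).comp_sub_right z
  rw [intervalIntegrable_iff_integrableOn_Icc_of_le (by linarith)] at h3
  have h4 : IntegrableOn (fun x : ℝ => |x - z| ^ r) (Set.Icc 0 1) volume :=
    h3.mono_set (Set.Icc_subset_Icc (by linarith [hz.2]) (by linarith [hz.1]))
  have hμ : μ.restrict (Set.Icc 0 1) = μ := Measure.restrict_eq_self_of_ae_mem hsupp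
  refine h4.of_measure_le_smul (c := ENNReal.ofReal M) ENNReal.ofReal_ne_top ?_
  rw [← hμ, ← Measure.restrict_smul]
  exact Measure.restrict_mono le_rfl hdens

/-- Logarithmic singularities are weaker than any power singularity. -/
lemma neg_log_rpow_sq_le {u α s : ℝ} (hu0 : 0 < u) (hu1 : u ≤ 1) (hα : 0 < α) (hs : 0 < s) :
    ((-Real.log u) ^ α) ^ 2 ≤ ((2 * α / s) ^ α) ^ 2 * u ^ (-s) := by
  have hlog : 0 ≤ -Real.log u := by linarith [Real.log_nonpos hu0.le hu1]
  have hε : 0 < s / (2 * α) := by positivity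
  have h := Real.log_le_rpow_div (inv_nonneg.2 hu0.le) hε
  rw [Real.log_inv] at h
  have h2 : (-Real.log u) ^ α ≤ (2 * α / s) ^ α * (u⁻¹) ^ (s / 2) := by
    calc (-Real.log u) ^ α ≤ (u⁻¹ ^ (s / (2 * α)) / (s / (2 * α))) ^ α :=
          Real.rpow_le_rpow hlog h hα.le
      _ = (2 * α / s) ^ α * (u⁻¹) ^ (s / 2) := by
          rw [div_eq_mul_inv, inv_div, mul_comm, Real.mul_rpow (by positivity) (by positivity),
            ← Real.rpow_mul (by positivity)]
          congr 2
          field_simp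
  have h3 := pow_le_pow_left₀ (Real.rpow_nonneg hlog α) h2 2
  refine h3.trans (le_of_eq ?_)
  rw [mul_pow, ← Real.rpow_natCast (u⁻¹ ^ (s / 2)), ← Real.rpow_mul (by positivity),
    Real.inv_rpow hu0.le, Real.rpow_neg hu0.le]
  congr 3
  push_cast
  ring

lemma integral_sub_integral_sq_le {μ : Measure ℝ} [IsProbabilityMeasure μ] {X : ℝ → ℝ}
    (hX : AEStronglyMeasurable X μ) :
    ∫ x, (X x - ∫ y, X y ∂μ) ^ 2 ∂μ ≤ ∫ x, X x ^ 2 ∂μ := by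
  rw [← ProbabilityTheory.variance_eq_integral hX.aemeasurable]
  exact ProbabilityTheory.variance_le_expectation_sq hX

/-- Replacing both factors of an autocorrelation by an approximation `F` of `Φ`. -/
lemma abs_integral_comp_mul_sub_le {μ : Measure ℝ} [IsProbabilityMeasure μ] {S : ℝ → ℝ}
    (hS : MeasurePreserving S μ μ) {Φ F : ℝ → ℝ} (hΦ : MemLp Φ 2 μ) (hF : MemLp F 2 μ)
    {t : ℝ} (ht : 0 < t) :
    |∫ x, Φ (S x) * Φ x ∂μ - ∫ x, F x * F (S x) ∂μ| ≤
      t / 2 * (∫ x, F x ^ 2 ∂μ + ∫ x, Φ x ^ 2 ∂μ) + t⁻¹ * ∫ x, (Φ x - F x) ^ 2 ∂μ := by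
  have hΨ : MemLp (fun x => Φ x - F x) 2 μ := hΦ.sub hF
  have hΦS : MemLp (fun x => Φ (S x)) 2 μ := hΦ.comp_measurePreserving hS
  have hFS : MemLp (fun x => F (S x)) 2 μ := hF.comp_measurePreserving hS
  have hΨS : MemLp (fun x => Φ (S x) - F (S x)) 2 μ := hΨ.comp_measurePreserving hS
  have hcomp : ∀ {X : ℝ → ℝ}, MemLp X 2 μ → ∫ x, X (S x) ^ 2 ∂μ = ∫ x, X x ^ 2 ∂μ := by
    intro X hX
    have := integral_map (μ := μ) hS.measurable.aemeasurable (f := fun x => X x ^ 2)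
      (by rw [hS.map_eq]; exact hX.aestronglyMeasurable.pow 2)
    rw [hS.map_eq] at this
    exact this.symm
  have j1 : Integrable (fun x => Φ (S x) * Φ x) μ := hΦS.integrable_mul hΦ
  have j2 : Integrable (fun x => F x * F (S x)) μ := hF.integrable_mul hFS
  rw [← integral_sub j1 j2]
  have i1 := hFS.integrable_sq
  have i2 := hΦ.integrable_sq
  have i3 := hΨ.integrable_sq
  have i4 := hΨS.integrable_sq
  have hpt : ∀ x, ‖Φ (S x) * Φ x - F x * F (S x)‖ ≤
      t / 2 * (F (S x) ^ 2 + Φ x ^ 2)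
        + t⁻¹ / 2 * ((Φ x - F x) ^ 2 + (Φ (S x) - F (S x)) ^ 2) := by
    intro x
    have amgm : ∀ a b : ℝ, |a * b| ≤ t / 2 * a ^ 2 + t⁻¹ / 2 * b ^ 2 := by
      intro a b
      have h := sq_nonneg (t * |a| - |b|)
      rw [abs_mul, ← sq_abs a, ← sq_abs b]
      have h' : 0 ≤ t⁻¹ / 2 * (t * |a| - |b|) ^ 2 := by positivity
      have e : t⁻¹ / 2 * (t * |a| - |b|) ^ 2
          = t / 2 * |a| ^ 2 + t⁻¹ / 2 * |b| ^ 2 - |a| * |b| := by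
        field_simp
        ring
      linarith
    have e : Φ (S x) * Φ x - F x * F (S x)
        = F (S x) * (Φ x - F x) + Φ x * (Φ (S x) - F (S x)) := by ring
    rw [e, Real.norm_eq_abs]
    have h1 := amgm (F (S x)) (Φ x - F x)
    have h2 := amgm (Φ x) (Φ (S x) - F (S x))
    have h3 := abs_add_le (F (S x) * (Φ x - F x)) (Φ x * (Φ (S x) - F (S x)))
    linarith
  have := norm_integral_le_of_norm_le
    (((i1.add i2).const_mul (t / 2)).add ((i3.add i4).const_mul (t⁻¹ / 2)))
    (Eventually.of_forall hpt)
  rw [Real.norm_eq_abs] at this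
  refine this.trans (le_of_eq ?_)
  rw [integral_add' ((i1.add i2).const_mul (t / 2)) ((i3.add i4).const_mul (t⁻¹ / 2)),
    integral_const_mul, integral_const_mul, integral_add' i1 i2, integral_add' i3 i4,
    hcomp hF, hcomp hΨ]
  ring

lemma bvNorm_comp_dist_le {G : ℝ → ℝ} (hG : Antitone G) {c K : ℝ}
    (hc : ∀ u, c ≤ G u) (hK : ∀ u, G u ≤ c + K) (habs : ∀ u, |G u| ≤ K)
    {z : ℝ} (hz : z ∈ Set.Icc (0 : ℝ) 1) :
    bvNorm (fun x => G |x - z|) ≤ 3 * K := by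
  have hK0 : 0 ≤ K := (abs_nonneg _).trans (habs 0)
  have h1 := ENNReal.toReal_le_of_le_ofReal (by positivity) (eVariationOn_comp_dist_le hG hc hK hz)
  have h2 : supNormIcc (fun x => G |x - z|) ≤ K := by
    have : Nonempty (Set.Icc (0 : ℝ) 1) := ⟨⟨z, hz⟩⟩
    exact ciSup_le fun x => habs _
  rw [bvNorm]
  linarith

/-- The profile `u ↦ (-log u) ^ α`, cut off to be constant for `u ≤ e⁻ⁿ` and for `1 ≤ u`. -/
noncomputable def truncNegLogRpow (α : ℝ) (n : ℕ) (u : ℝ) : ℝ :=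
  (-Real.log (min 1 (max u (Real.exp (-n))))) ^ α

lemma neg_log_trunc_mem (n : ℕ) (u : ℝ) :
    -Real.log (min 1 (max u (Real.exp (-n)))) ∈ Set.Icc (0 : ℝ) n := by
  have he : Real.exp (-n) ≤ min 1 (max u (Real.exp (-n))) :=
    le_min (Real.exp_le_one_iff.2 (by simp)) (le_max_right _ _)
  have hpos := (Real.exp_pos (-(n : ℝ))).trans_le he
  have h1 := Real.log_nonpos hpos.le (min_le_left _ _)
  have h2 := (Real.le_log_iff_exp_le hpos).2 he
  constructor <;> linarith

lemma truncNegLogRpow_nonneg (α : ℝ) (n : ℕ) (u : ℝ) : 0 ≤ truncNegLogRpow α n u :=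
  Real.rpow_nonneg (neg_log_trunc_mem n u).1 α

lemma truncNegLogRpow_le {α : ℝ} (hα : 0 ≤ α) (n : ℕ) (u : ℝ) :
    truncNegLogRpow α n u ≤ (n : ℝ) ^ α :=
  Real.rpow_le_rpow (neg_log_trunc_mem n u).1 (neg_log_trunc_mem n u).2 hα

lemma truncNegLogRpow_antitone {α : ℝ} (hα : 0 ≤ α) (n : ℕ) : Antitone (truncNegLogRpow α n) := by
  intro u v huv
  refine Real.rpow_le_rpow (neg_log_trunc_mem n v).1 (neg_le_neg (Real.log_le_log ?_ ?_)) hα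
  · exact lt_min one_pos ((Real.exp_pos _).trans_le (le_max_right _ _))
  · gcongr

lemma measurable_truncNegLogRpow (α : ℝ) (n : ℕ) : Measurable (truncNegLogRpow α n) := by
  unfold truncNegLogRpow
  fun_prop

/-- The error of the cutoff is small compared to an integrable power. -/
lemma sub_truncNegLogRpow_sq_le {u α s r : ℝ} (hu0 : 0 < u) (hu1 : u ≤ 1) (hα : 0 < α)
    (hs : 0 < s) (hr : 0 ≤ r) (n : ℕ) :
    ((-Real.log u) ^ α - truncNegLogRpow α n u) ^ 2 ≤
      ((2 * α / s) ^ α) ^ 2 * Real.exp (-n) ^ r * u ^ (-(s + r)) := by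
  rcases le_or_gt (Real.exp (-n)) u with h | h
  · have : truncNegLogRpow α n u = (-Real.log u) ^ α := by
      rw [truncNegLogRpow, max_eq_left h, min_eq_right hu1]
    rw [this, sub_self, zero_pow two_ne_zero]
    positivity
  · have hlog : 0 ≤ -Real.log u := by linarith [Real.log_nonpos hu0.le hu1]
    have hle : truncNegLogRpow α n u ≤ (-Real.log u) ^ α := by
      refine Real.rpow_le_rpow (neg_log_trunc_mem n u).1 (neg_le_neg ?_) hα.le
      exact Real.log_le_log hu0 (le_min hu1 (le_max_left _ _))
    have h0 := truncNegLogRpow_nonneg α n u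
    calc ((-Real.log u) ^ α - truncNegLogRpow α n u) ^ 2 ≤ ((-Real.log u) ^ α) ^ 2 :=
          pow_le_pow_left₀ (by linarith) (by linarith) 2
      _ ≤ ((2 * α / s) ^ α) ^ 2 * u ^ (-s) := neg_log_rpow_sq_le hu0 hu1 hα hs
      _ = ((2 * α / s) ^ α) ^ 2 * u ^ r * u ^ (-(s + r)) := by
          rw [mul_assoc, ← Real.rpow_add hu0]
          congr 2
          ring
      _ ≤ _ := by gcongr

lemma exists_rpow_mul_pow_le {ρ β a : ℝ} (hρ : 0 < ρ) (hβ : β < -Real.log ρ) :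
    ∃ C > (0 : ℝ), ∀ n : ℕ, (n : ℝ) ^ a * ρ ^ n ≤ C * Real.exp (-β * n) := by
  have h := (tendsto_rpow_mul_exp_neg_mul_atTop_nhds_zero a (-Real.log ρ - β)
    (by linarith)).comp tendsto_natCast_atTop_atTop
  obtain ⟨C, hC⟩ := h.bddAbove_range
  refine ⟨max C 1, by positivity, fun n => ?_⟩
  have hn : (n : ℝ) ^ a * Real.exp (-(-Real.log ρ - β) * n) ≤ C := hC ⟨n, rfl⟩
  have e : ρ ^ n = Real.exp (-(-Real.log ρ - β) * n) * Real.exp (-β * n) := by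
    rw [← Real.exp_add, ← Real.rpow_natCast, Real.rpow_def_of_pos hρ]
    congr 1
    ring
  rw [e, ← mul_assoc]
  gcongr
  exact hn.trans (le_max_left _ _)

/-- Exponential decay of autocorrelations for `φ(x) = (−log|x−z|)^α` when the transfer
operator has a spectral gap on BV: for every `β < min{−log ρ, 1/2}` there is `C_β > 0`
with `|∫ (φ∘T^n − φ̄)(φ − φ̄) dμ| ≤ C_β e^{−βn}` for all `n`. -/
theorem exp_decay_autocorrelations
    (T : ℝ → ℝ) (hmeas : Measurable T)
    (hmaps : Set.MapsTo T (Set.Icc (0 : ℝ) 1) (Set.Icc (0 : ℝ) 1))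
    (μ : Measure ℝ) [IsProbabilityMeasure μ] (hsupp : μ (Set.Icc (0 : ℝ) 1)ᶜ = 0)
    (hT : MeasurePreserving T μ μ)
    (M : ℝ) (hM : 0 < M)
    (hdens : μ ≤ (ENNReal.ofReal M) • (MeasureTheory.volume : Measure ℝ))
    (P : (ℝ → ℝ) → (ℝ → ℝ))
    (hPdual : ∀ f g : ℝ → ℝ, Integrable f μ → Measurable g → (∃ B : ℝ, ∀ x, |g x| ≤ B) →
      ∫ x, P f x * g x ∂μ = ∫ x, f x * g (T x) ∂μ)
    (C_P ρ : ℝ) (hC_P : 0 < C_P) (hρ0 : 0 < ρ) (hρ1 : ρ < 1)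
    (hPdecay : ∀ f : ℝ → ℝ, eVariationOn f (Set.Icc (0 : ℝ) 1) ≠ ⊤ →
      (∫ x, f x ∂μ) = 0 →
      ∀ n : ℕ, ∀ x ∈ Set.Icc (0 : ℝ) 1, |(P^[n] f) x| ≤ C_P * ρ ^ n * bvNorm f)
    (z : ℝ) (hz : z ∈ Set.Icc (0 : ℝ) 1) (α : ℝ) (hα : 0 < α)
    (φ : ℝ → ℝ) (hφ : ∀ x, φ x = (-Real.log |x - z|) ^ α)
    (φbar : ℝ) (hφbar : φbar = ∫ x, φ x ∂μ) :
    ∀ β : ℝ, β < min (-Real.log ρ) (1 / 2) → ∃ C > (0 : ℝ), ∀ n : ℕ,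
      |∫ x, (φ (T^[n] x) - φbar) * (φ x - φbar) ∂μ| ≤ C * Real.exp (-β * n) := by
  intro β hβ
  obtain ⟨hβ1, hβ2⟩ := lt_min_iff.1 hβ
  set r := max (2 * β) (1 / 2) with hr
  have hr1 : r < 1 := max_lt (by linarith) (by norm_num)
  have hr0 : 0 < r := lt_of_lt_of_le (by norm_num) (le_max_right (2 * β) (1 / 2))
  have hrβ : 2 * β ≤ r := le_max_left _ _
  set s := (1 - r) / 2 with hs
  have hs0 : 0 < s := by linarith
  have hmem : ∀ᵐ x ∂μ, x ∈ Set.Icc (0 : ℝ) 1 := hsupp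
  have hz0 : ∀ᵐ x ∂μ, x ≠ z := by
    have : μ {z} ≤ 0 := (hdens {z}).trans (by simp)
    simpa [ae_iff] using this
  have hdist : ∀ᵐ x ∂μ, 0 < |x - z| ∧ |x - z| ≤ 1 := by
    filter_upwards [hmem, hz0] with x hx hxz
    exact ⟨abs_pos.2 (sub_ne_zero.2 hxz),
      abs_le.2 ⟨by linarith [hx.1, hz.2], by linarith [hx.2, hz.1]⟩⟩
  have hφeq : φ = fun x => (-Real.log |x - z|) ^ α := funext hφ
  have hφm : Measurable φ := by
    rw [hφeq]
    fun_prop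
  have hI := integrable_abs_sub_rpow hsupp hdens hz (r := -(s + r)) (by linarith)
  have hφ2 : MemLp φ 2 μ := by
    rw [memLp_two_iff_integrable_sq hφm.aestronglyMeasurable]
    refine (hI.const_mul (((2 * α / (s + r)) ^ α) ^ 2)).mono'
      (hφm.pow_const 2).aestronglyMeasurable ?_
    filter_upwards [hdist] with x hx
    rw [Real.norm_of_nonneg (sq_nonneg _), hφ]
    exact neg_log_rpow_sq_le hx.1 hx.2 hα (by linarith)
  have hφi : Integrable φ μ := hφ2.integrable (by norm_num)
  set A := ∫ x, φ x ^ 2 ∂μ with hA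
  set B := ((2 * α / s) ^ α) ^ 2 * ∫ x, |x - z| ^ (-(s + r)) ∂μ with hB
  have hA0 : 0 ≤ A := integral_nonneg fun x => sq_nonneg _
  have hB0 : 0 ≤ B := mul_nonneg (sq_nonneg _) (integral_nonneg fun x => by positivity)
  obtain ⟨C, hC0, hC⟩ := exists_rpow_mul_pow_le (a := 2 * α) hρ0 hβ1
  refine ⟨3 * C_P * C + (A + B), by positivity, fun n => ?_⟩
  -- the truncated observable and its centred version
  set K := (n : ℝ) ^ α with hK
  have hK0 : 0 ≤ K := by positivity
  set h := fun x => truncNegLogRpow α n |x - z| with hh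
  have hhm : Measurable h := (measurable_truncNegLogRpow α n).comp (by fun_prop)
  have hh0 : ∀ x, 0 ≤ h x := fun x => truncNegLogRpow_nonneg α n _
  have hhK : ∀ x, h x ≤ K := fun x => truncNegLogRpow_le hα.le n _
  have hh2 : MemLp h 2 μ := MemLp.of_bound hhm.aestronglyMeasurable K
    (Eventually.of_forall fun x => by rw [Real.norm_of_nonneg (hh0 x)]; exact hhK x)
  have hhi : Integrable h μ := hh2.integrable (by norm_num)
  set m := ∫ x, h x ∂μ with hm
  have hm0 : 0 ≤ m := integral_nonneg hh0
  have hmK : m ≤ K := by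
    have := integral_mono hhi (integrable_const K) hhK
    simpa using this
  have hFint : Integrable (fun x => h x - m) μ := hhi.sub (integrable_const m)
  have hF0 : ∫ x, (h x - m) ∂μ = 0 := by
    rw [integral_sub hhi (integrable_const m)]
    simp [hm]
  have hanti : Antitone fun u => truncNegLogRpow α n u - m := fun u v huv =>
    sub_le_sub_right (truncNegLogRpow_antitone hα.le n huv) m
  have hlow : ∀ u, -m ≤ truncNegLogRpow α n u - m := fun u => by
    linarith [truncNegLogRpow_nonneg α n u]
  have hup : ∀ u, truncNegLogRpow α n u - m ≤ -m + K := fun u => by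
    linarith [truncNegLogRpow_le hα.le n u]
  have habs : ∀ u, |truncNegLogRpow α n u - m| ≤ K := fun u =>
    abs_le.2 ⟨by linarith [hlow u], by linarith [hup u]⟩
  have hbv := bvNorm_comp_dist_le hanti hlow hup habs hz
  have hvar := ((eVariationOn_comp_dist_le hanti hlow hup hz).trans_lt ENNReal.ofReal_lt_top).ne
  have hmain : |∫ x, (h x - m) * (h (T^[n] x) - m) ∂μ| ≤ C_P * ρ ^ n * (3 * K) * K := by
    refine abs_integral_mul_comp_iterate_le hmeas hmem hPdual hFint hF0
      (b := fun k => C_P * ρ ^ k * (3 * K)) (fun k => by positivity) (fun k x hx => ?_)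
      (hhm.sub_const m) hK0 (fun x => habs _) n
    exact (hPdecay _ hvar hF0 k x hx).trans (by gcongr)
  -- the error made by truncating
  have herr : ∫ x, ((φ x - φbar) - (h x - m)) ^ 2 ∂μ ≤ Real.exp (-n) ^ r * B := by
    have e : ∀ x, (φ x - φbar) - (h x - m) = (φ x - h x) - ∫ y, (φ y - h y) ∂μ := fun x => by
      rw [integral_sub hφi hhi, hφbar]
      ring
    simp only [e]
    refine (integral_sub_integral_sq_le (hφm.sub hhm).aestronglyMeasurable).trans ?_
    rw [hB, ← mul_assoc, mul_comm (Real.exp (-n) ^ r), ← integral_const_mul]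
    refine integral_mono_ae (hφ2.sub hh2).integrable_sq (hI.const_mul _) ?_
    filter_upwards [hdist] with x hx
    rw [Pi.sub_apply, hφ]
    exact sub_truncNegLogRpow_sq_le hx.1 hx.2 hα hs0 hr0.le n
  have hΦA : ∫ x, (φ x - φbar) ^ 2 ∂μ ≤ A := by
    rw [hφbar]
    exact integral_sub_integral_sq_le hφm.aestronglyMeasurable
  have hFA : ∫ x, (h x - m) ^ 2 ∂μ ≤ A := by
    refine (integral_sub_integral_sq_le hhm.aestronglyMeasurable).trans ?_
    refine integral_mono_ae hh2.integrable_sq hφ2.integrable_sq ?_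
    filter_upwards [hdist] with x hx
    refine pow_le_pow_left₀ (hh0 x) ?_ 2
    rw [hφ]
    refine Real.rpow_le_rpow (neg_log_trunc_mem n _).1 (neg_le_neg ?_) hα.le
    exact Real.log_le_log hx.1 (le_min hx.2 (le_max_left _ _))
  set t := Real.exp (-n) ^ (r / 2) with ht
  have ht0 : 0 < t := by positivity
  have ht2 : Real.exp (-n) ^ r = t * t := by
    rw [ht, ← Real.rpow_add (Real.exp_pos _)]
    congr 1
    ring
  have htβ : t ≤ Real.exp (-β * n) := by
    rw [ht, ← Real.exp_mul]
    refine Real.exp_le_exp.2 ?_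
    nlinarith [n.cast_nonneg (α := ℝ)]
  have hdiff := abs_integral_comp_mul_sub_le (hT.iterate n) (Φ := fun x => φ x - φbar)
    (F := fun x => h x - m) (hφ2.sub (memLp_const φbar)) (hh2.sub (memLp_const m)) ht0
  have hdiff' : t / 2 * (∫ x, (h x - m) ^ 2 ∂μ + ∫ x, (φ x - φbar) ^ 2 ∂μ)
      + t⁻¹ * ∫ x, ((φ x - φbar) - (h x - m)) ^ 2 ∂μ ≤ t * (A + B) := by
    have h1 : t / 2 * (∫ x, (h x - m) ^ 2 ∂μ + ∫ x, (φ x - φbar) ^ 2 ∂μ) ≤ t / 2 * (A + A) := by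
      gcongr
    have h2 : t⁻¹ * ∫ x, ((φ x - φbar) - (h x - m)) ^ 2 ∂μ ≤ t⁻¹ * (t * t * B) := by
      rw [← ht2]
      gcongr
    have h3 : t⁻¹ * (t * t * B) = t * B := by
      field_simp
    linarith
  have hKK : K * K * ρ ^ n ≤ C * Real.exp (-β * n) := by
    have : K * K = (n : ℝ) ^ (2 * α) := by
      rw [mul_comm 2 α, Real.rpow_mul n.cast_nonneg, ← hK]
      norm_num [sq]
    rw [this]
    exact hC n
  have hfin : t * (A + B) ≤ Real.exp (-β * n) * (A + B) := by gcongr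
  have hfin' : C_P * ρ ^ n * (3 * K) * K ≤ 3 * C_P * (C * Real.exp (-β * n)) := by
    calc _ = 3 * C_P * (K * K * ρ ^ n) := by ring
      _ ≤ _ := by gcongr
  have htri := abs_add_le
    (∫ x, (φ (T^[n] x) - φbar) * (φ x - φbar) ∂μ - ∫ x, (h x - m) * (h (T^[n] x) - m) ∂μ)
    (∫ x, (h x - m) * (h (T^[n] x) - m) ∂μ)
  rw [sub_add_cancel] at htri
  linarith [hdiff.trans hdiff']
end
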